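/- arXiv:1507.06816 — 3 statements merged into one kernel-verified Lean document; each statement's English description precedes it below -/
import Mathlib

section
/- Let X be a complex Banach space, Ω ⊂ ℂ open, and let F : Ω → B(X) be analytic with F(λ) a finite rank operator for every λ ∈ Ω. Then the maps λ ↦ det(I−F(λ)) and λ ↦ tr(F(λ)) are analytic on Ω. -/
open scoped ENNReal

variable {X : Type*} [NormedAddCommGroup X] [NormedSpace ℂ X] [CompleteSpace X]

/-- A continuous linear operator has finite rank. -/
def IsFiniteRank (F : X →L[ℂ] X) : Prop :=
  FiniteDimensional ℂ (LinearMap.range (F : X →ₗ[ℂ] X))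

/-- `det(I - F)`, defined as the determinant of the restriction of `I - F` to the
(finite-dimensional) range of `F`. -/
noncomputable def detOneSub (F : X →L[ℂ] X) : ℂ :=
  LinearMap.det
    ((LinearMap.id : LinearMap.range (F : X →ₗ[ℂ] X) →ₗ[ℂ] LinearMap.range (F : X →ₗ[ℂ] X)) -
      (F : X →ₗ[ℂ] X).restrict fun x _ => LinearMap.mem_range_self _ x)

/-- `tr F`, the trace of the restriction of `F` to its range. -/
noncomputable def trOn (F : X →L[ℂ] X) : ℂ :=
  LinearMap.trace ℂ (LinearMap.range (F : X →ₗ[ℂ] X))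
    ((F : X →ₗ[ℂ] X).restrict fun x _ => LinearMap.mem_range_self _ x)

/-- The `p`-regularized determinant `det_p(I-F)` of a finite rank operator. -/
noncomputable def detp (p : ℝ) (F : X →L[ℂ] X) : ℂ :=
  detOneSub F * Complex.exp (∑ k ∈ Finset.Icc 1 (⌈p⌉₊ - 1), trOn (F ^ k) / (k : ℂ))

open Polynomial in
theorem LinearMap.det_aeval_eq_prod_roots_charpoly {K V : Type*} [Field K] [IsAlgClosed K]
    [AddCommGroup V] [Module K V] [FiniteDimensional K V] (g : Module.End K V) (p : K[X]) :
    LinearMap.det (aeval g p) = (g.charpoly.roots.map fun t => p.eval t).prod := by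
  have hcard : Multiset.card g.charpoly.roots = Module.finrank K V := by
    rw [← (IsAlgClosed.splits g.charpoly).natDegree_eq_card_roots, LinearMap.charpoly_natDegree]
  have hlin : ∀ a : K, LinearMap.det (aeval g (X - C a)) =
      (g.charpoly.roots.map fun t => (X - C a).eval t).prod := by
    intro a
    have h1 : aeval g (X - C a) = (-1 : K) • (algebraMap K (Module.End K V) a - g) := by
      simp
    have h2 : (g.charpoly.roots.map fun t => (X - C a).eval t) =
        g.charpoly.roots.map fun t => -1 * (a - t) := by
      congr 1; ext t; simp
    rw [h1, LinearMap.det_smul, ← LinearMap.eval_charpoly,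
      (IsAlgClosed.splits g.charpoly).eval_eq_prod_roots_of_monic g.charpoly_monic, h2,
      Multiset.prod_map_mul, Multiset.map_const', Multiset.prod_replicate, hcard]
  rw [(IsAlgClosed.splits p).eq_prod_roots]
  generalize p.leadingCoeff = c
  induction p.roots using Multiset.induction_on with
  | empty =>
    simp [hcard, Algebra.algebraMap_eq_smul_one, LinearMap.det_smul]
  | cons a s ih =>
    rw [Multiset.map_cons, Multiset.prod_cons, mul_left_comm, map_mul, map_mul, ih, hlin]
    simp only [eval_mul, Multiset.prod_map_mul]

open Polynomial in
theorem LinearMap.trace_pow_eq_sum_roots_charpoly {K V : Type*} [Field K] [IsAlgClosed K]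
    [AddCommGroup V] [Module K V] [FiniteDimensional K V] (g : Module.End K V) (k : ℕ) :
    LinearMap.trace K V (g ^ k) = (g.charpoly.roots.map fun t => t ^ k).sum := by
  have h : (g ^ k).charpoly = ((g.charpoly.roots.map fun t => t ^ k).map fun a => X - C a).prod := by
    have := IsAlgClosed.instInfinite (K := K)
    refine Polynomial.funext fun r => ?_
    have h1 : algebraMap K (Module.End K V) r - g ^ k = aeval g (C r - X ^ k) := by simp
    rw [LinearMap.eval_charpoly, h1, LinearMap.det_aeval_eq_prod_roots_charpoly,
      eval_multiset_prod, Multiset.map_map, Multiset.map_map]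
    simp
  rw [Module.End.trace_eq_sum_roots_charpoly_of_splits (IsAlgClosed.splits _), h,
    roots_multiset_prod_X_sub_C]

/-- Newton's identities for the elementary symmetric functions of a multiset. -/
theorem Multiset.mul_esymm_eq_sum {R : Type*} [CommRing R] (s : Multiset R) (k : ℕ) :
    k * s.esymm k = (-1) ^ (k + 1) *
      ∑ a ∈ Finset.HasAntidiagonal.antidiagonal k with a.1 < k,
        (-1) ^ a.1 * s.esymm a.1 * (s.map fun t => t ^ a.2).sum := by
  classical
  have h := congrArg (MvPolynomial.aeval (fun x : s.ToType => x.1))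
    (MvPolynomial.mul_esymm_eq_sum s.ToType R k)
  have hs : ((Finset.univ : Finset s.ToType).val.map fun x => x.1) = s := s.map_univ_coe
  have hp : ∀ j, MvPolynomial.aeval (fun x : s.ToType => x.1) (MvPolynomial.psum s.ToType R j) =
      (s.map fun t => t ^ j).sum := by
    intro j
    conv_rhs => rw [← hs]
    rw [Multiset.map_map, MvPolynomial.psum, map_sum]
    simp only [map_pow, MvPolynomial.aeval_X]
    rfl
  simp only [map_mul, map_natCast, map_pow, map_neg, map_one, map_sum,
    MvPolynomial.aeval_esymm_eq_multiset_esymm, hs, hp] at h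
  exact h

theorem Multiset.prod_map_one_sub_eq_sum_esymm {R : Type*} [CommRing R] (s : Multiset R) {n : ℕ}
    (hn : Multiset.card s ≤ n) :
    (s.map fun t => 1 - t).prod = ∑ j ∈ Finset.range (n + 1), (-1) ^ j * s.esymm j := by
  have h := congrArg (Polynomial.eval 1) (Multiset.prod_X_add_C_eq_sum_esymm (s.map Neg.neg))
  rw [Polynomial.eval_multiset_prod, Polynomial.eval_finsetSum] at h
  simp only [Multiset.map_map, Function.comp_def, Polynomial.eval_add, Polynomial.eval_X,
    Polynomial.eval_C, Polynomial.eval_mul, Polynomial.eval_pow, one_pow, mul_one,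
    Multiset.card_map, Multiset.esymm_neg, ← sub_eq_add_neg] at h
  rw [h]
  refine Finset.sum_subset (Finset.range_mono (Nat.add_le_add_right hn 1)) fun j _ hj => ?_
  have : Multiset.card s < j := by
    rw [Finset.mem_range] at hj
    omega
  simp [Multiset.esymm, Multiset.powersetCard_eq_empty _ this]

variable {E : Type*} [NormedAddCommGroup E] [NormedSpace ℂ E]

theorem ContinuousLinearMap.rank_le_iff_forall_det_eq_zero (F : E →L[ℂ] E) (n : ℕ) :
    (F : E →ₗ[ℂ] E).rank ≤ n ↔ ∀ (x : Fin (n + 1) → E) (φ : Fin (n + 1) → StrongDual ℂ E),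
      (Matrix.of fun i j => φ i (F (x j))).det = 0 := by
  constructor
  · intro h x φ
    by_contra hdet
    have h1 := Matrix.linearIndependent_cols_of_det_ne_zero hdet
    let L : LinearMap.range (F : E →ₗ[ℂ] E) →ₗ[ℂ] (Fin (n + 1) → ℂ) :=
      LinearMap.pi fun i => (φ i : E →ₗ[ℂ] ℂ) ∘ₗ Submodule.subtype _
    have h2 : LinearIndependent ℂ
        (fun j => (⟨F (x j), x j, rfl⟩ : LinearMap.range (F : E →ₗ[ℂ] E))) :=
      LinearIndependent.of_comp L h1
    have h3 := h2.cardinal_lift_le_rank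
    have h4 : ((n + 1 : ℕ) : Cardinal) ≤ (F : E →ₗ[ℂ] E).rank := by simpa using h3
    have h5 := h4.trans h
    norm_cast at h5
    omega
  · intro h
    by_contra hlt
    have h1 : ((n + 1 : ℕ) : Cardinal) ≤ (F : E →ₗ[ℂ] E).rank := by
      have := Order.succ_le_of_lt (not_le.mp hlt)
      simpa [← Cardinal.succ_natCast] using this
    obtain ⟨s, hs, hli⟩ := LinearMap.le_rank_iff_exists_linearIndependent_finset.mp h1
    let e : Fin (n + 1) ≃ s := (s.equivFinOfCardEq hs).symm
    have hli' : LinearIndependent ℂ fun j => F (e j : E) :=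
      hli.comp e e.injective
    have hsurj := SeparatingDual.dualMap_surjective_iff.mpr
      (show Function.Injective (Fintype.linearCombination ℂ fun j => F (e j : E)) from
        hli'.fintypeLinearCombination_injective)
    choose φ hφ using fun i : Fin (n + 1) => hsurj (LinearMap.proj i)
    have h2 := h (fun j => (e j : E)) φ
    have h3 : (Matrix.of fun i j => φ i (F (e j : E))) = 1 := by
      ext i j
      have := LinearMap.congr_fun (hφ i) (Pi.single j 1)
      simpa [Matrix.one_apply, Pi.single_apply, Fintype.linearCombination_apply_single] using this
    rw [h3, Matrix.det_one] at h2
    exact one_ne_zero h2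

theorem isClosed_setOf_rank_le (n : ℕ) : IsClosed {F : E →L[ℂ] E | (F : E →ₗ[ℂ] E).rank ≤ n} := by
  have h := (isOpen_setOfPred_nat_le_rank (𝕜 := ℂ) (E := E) (F := E) (n + 1)).isClosed_compl
  convert h using 1
  ext F
  rw [Set.mem_compl_iff, Set.mem_ofPred_eq, Set.mem_ofPred_eq, not_le]
  push_cast
  rw [← Cardinal.succ_natCast, Order.lt_succ_iff]

theorem isFiniteRank_of_rank_le {F : E →L[ℂ] E} {n : ℕ} (h : (F : E →ₗ[ℂ] E).rank ≤ n) :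
    IsFiniteRank F :=
  Module.rank_lt_aleph0_iff.mp (h.trans_lt Cardinal.natCast_lt_aleph0)

theorem trOn_eq_trace_restrict {F : E →L[ℂ] E} {W : Submodule ℂ E} [FiniteDimensional ℂ W]
    (hF : ∀ x, (F : E →ₗ[ℂ] E) x ∈ W) :
    trOn F = LinearMap.trace ℂ W ((F : E →ₗ[ℂ] E).restrict fun x _ => hF x) := by
  have hle : LinearMap.range (F : E →ₗ[ℂ] E) ≤ W := by
    rintro _ ⟨x, rfl⟩
    exact hF x
  have : FiniteDimensional ℂ (LinearMap.range (F : E →ₗ[ℂ] E)) :=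
    Submodule.finiteDimensional_of_le hle
  exact LinearMap.trace_comp_comm' (Submodule.inclusion hle)
    ((F : E →ₗ[ℂ] E).rangeRestrict ∘ₗ W.subtype)

theorem trOn_sub {F G : E →L[ℂ] E} (hF : IsFiniteRank F) (hG : IsFiniteRank G) :
    trOn (F - G) = trOn F - trOn G := by
  have : FiniteDimensional ℂ (LinearMap.range (F : E →ₗ[ℂ] E)) := hF
  have : FiniteDimensional ℂ (LinearMap.range (G : E →ₗ[ℂ] E)) := hG
  let W := LinearMap.range (F : E →ₗ[ℂ] E) ⊔ LinearMap.range (G : E →ₗ[ℂ] E)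
  have h1 : ∀ x, (F : E →ₗ[ℂ] E) x ∈ W := fun x => Submodule.mem_sup_left ⟨x, rfl⟩
  have h2 : ∀ x, (G : E →ₗ[ℂ] E) x ∈ W := fun x => Submodule.mem_sup_right ⟨x, rfl⟩
  have h3 : ∀ x, ((F - G : E →L[ℂ] E) : E →ₗ[ℂ] E) x ∈ W := fun x => W.sub_mem (h1 x) (h2 x)
  rw [trOn_eq_trace_restrict h1, trOn_eq_trace_restrict h2, trOn_eq_trace_restrict h3, ← map_sub]
  rfl

theorem trOn_smul {F : E →L[ℂ] E} (hF : IsFiniteRank F) (c : ℂ) : trOn (c • F) = c * trOn F := by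
  have : FiniteDimensional ℂ (LinearMap.range (F : E →ₗ[ℂ] E)) := hF
  have h1 : ∀ x, (F : E →ₗ[ℂ] E) x ∈ LinearMap.range (F : E →ₗ[ℂ] E) := fun x => ⟨x, rfl⟩
  have h2 : ∀ x, ((c • F : E →L[ℂ] E) : E →ₗ[ℂ] E) x ∈ LinearMap.range (F : E →ₗ[ℂ] E) :=
    fun x => Submodule.smul_mem _ c (h1 x)
  rw [trOn_eq_trace_restrict h1, trOn_eq_trace_restrict h2, ← smul_eq_mul, ← map_smul]
  rfl

theorem norm_trOn_le {F : E →L[ℂ] E} {n : ℕ} (h : (F : E →ₗ[ℂ] E).rank ≤ n) :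
    ‖trOn F‖ ≤ n * ‖F‖ := by
  have : FiniteDimensional ℂ (LinearMap.range (F : E →ₗ[ℂ] E)) := isFiniteRank_of_rank_le h
  let g : Module.End ℂ (LinearMap.range (F : E →ₗ[ℂ] E)) :=
    (F : E →ₗ[ℂ] E).restrict fun x _ => LinearMap.mem_range_self _ x
  have hcard : Multiset.card g.charpoly.roots ≤ n := by
    rw [← (IsAlgClosed.splits g.charpoly).natDegree_eq_card_roots, LinearMap.charpoly_natDegree]
    exact Module.finrank_le_of_rank_le h
  have hbound : ∀ t ∈ g.charpoly.roots, ‖t‖ ≤ ‖F‖ := by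
    intro t ht
    obtain ⟨v, hv⟩ := ((Module.End.hasEigenvalue_iff_isRoot_charpoly g t).mpr
      (Polynomial.isRoot_of_mem_roots ht)).exists_hasEigenvector
    have h1 : F v = t • (v : E) := congrArg Subtype.val hv.apply_eq_smul
    have h2 : 0 < ‖(v : E)‖ := by
      rw [norm_pos_iff]
      exact fun h0 => hv.2 (Subtype.ext h0)
    have h3 := F.le_opNorm (v : E)
    rw [h1, norm_smul] at h3
    exact le_of_mul_le_mul_right h3 h2
  calc ‖trOn F‖ = ‖g.charpoly.roots.sum‖ := by
        rw [← Module.End.trace_eq_sum_roots_charpoly_of_splits (IsAlgClosed.splits _)]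
        rfl
    _ ≤ (g.charpoly.roots.map fun t => ‖t‖).sum := norm_multiset_sum_le _
    _ ≤ Multiset.card (g.charpoly.roots.map fun t => ‖t‖) • ‖F‖ := by
        refine Multiset.sum_le_card_nsmul _ _ fun x hx => ?_
        obtain ⟨t, ht, rfl⟩ := Multiset.mem_map.mp hx
        exact hbound t ht
    _ ≤ n * ‖F‖ := by
        rw [Multiset.card_map, nsmul_eq_mul]
        gcongr

/-- A finite rank operator has a finite multiset of eigenvalues computing `det (I - F)` and the
traces of the powers of `F`. -/
theorem exists_multiset_detOneSub_trOn_pow {F : E →L[ℂ] E} {n : ℕ}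
    (h : (F : E →ₗ[ℂ] E).rank ≤ n) :
    ∃ s : Multiset ℂ, Multiset.card s ≤ n ∧ detOneSub F = (s.map fun t => 1 - t).prod ∧
      ∀ k, 1 ≤ k → trOn (F ^ k) = (s.map fun t => t ^ k).sum := by
  have : FiniteDimensional ℂ (LinearMap.range (F : E →ₗ[ℂ] E)) := isFiniteRank_of_rank_le h
  let g : Module.End ℂ (LinearMap.range (F : E →ₗ[ℂ] E)) :=
    (F : E →ₗ[ℂ] E).restrict fun x _ => LinearMap.mem_range_self _ x
  refine ⟨g.charpoly.roots, ?_, ?_, fun k hk => ?_⟩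
  · rw [← (IsAlgClosed.splits g.charpoly).natDegree_eq_card_roots, LinearMap.charpoly_natDegree]
    exact Module.finrank_le_of_rank_le h
  · rw [← (IsAlgClosed.splits g.charpoly).eval_eq_prod_roots_of_monic g.charpoly_monic,
      LinearMap.eval_charpoly, map_one]
    rfl
  · have hmem : ∀ x, ((F ^ k : E →L[ℂ] E) : E →ₗ[ℂ] E) x ∈ LinearMap.range (F : E →ₗ[ℂ] E) := by
      intro x
      obtain ⟨j, rfl⟩ := Nat.exists_eq_add_of_le' hk
      rw [pow_succ']
      exact ⟨(F ^ j) x, rfl⟩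
    rw [trOn_eq_trace_restrict hmem, ← LinearMap.trace_pow_eq_sum_roots_charpoly,
      Module.End.pow_restrict]
    congr 1
    ext x
    simp

theorem rank_pow_le {F : E →L[ℂ] E} {k : ℕ} (hk : 1 ≤ k) :
    ((F ^ k : E →L[ℂ] E) : E →ₗ[ℂ] E).rank ≤ (F : E →ₗ[ℂ] E).rank := by
  obtain ⟨j, rfl⟩ := Nat.exists_eq_add_of_le' hk
  rw [pow_succ']
  exact LinearMap.rank_comp_le_left ((F ^ j : E →L[ℂ] E) : E →ₗ[ℂ] E) (F : E →ₗ[ℂ] E)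

theorem rank_smul_sub_le {F G : E →L[ℂ] E} {m n : ℕ} (hF : (F : E →ₗ[ℂ] E).rank ≤ m)
    (hG : (G : E →ₗ[ℂ] E).rank ≤ n) (c : ℂ) :
    ((c • (F - G) : E →L[ℂ] E) : E →ₗ[ℂ] E).rank ≤ (m + n : ℕ) := by
  have h1 : ((c • (F - G) : E →L[ℂ] E) : E →ₗ[ℂ] E) =
      (F : E →ₗ[ℂ] E).comp (c • LinearMap.id) + (G : E →ₗ[ℂ] E).comp (-c • LinearMap.id) := by
    ext x
    simp [sub_eq_add_neg]
  rw [h1, Nat.cast_add]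
  exact (LinearMap.rank_add_le _ _).trans
    (add_le_add ((LinearMap.rank_comp_le_left _ _).trans hF)
      ((LinearMap.rank_comp_le_left _ _).trans hG))

open Filter Topology in
theorem differentiableAt_trOn {f : ℂ → E →L[ℂ] E} {z : ℂ} {n : ℕ} (hf : DifferentiableAt ℂ f z)
    (hr : ∀ᶠ w in 𝓝 z, (f w : E →ₗ[ℂ] E).rank ≤ n) :
    DifferentiableAt ℂ (fun w => trOn (f w)) z := by
  have hslope := hasDerivAt_iff_tendsto_slope.mp hf.hasDerivAt
  have hrz := hr.self_of_nhds
  have hrank : ∀ᶠ w in 𝓝[≠] z, ((slope f z w : E →L[ℂ] E) : E →ₗ[ℂ] E).rank ≤ (n + n : ℕ) := by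
    filter_upwards [nhdsWithin_le_nhds hr] with w hw
    rw [slope_def_module]
    exact rank_smul_sub_le hw hrz _
  have hderiv : ((deriv f z : E →L[ℂ] E) : E →ₗ[ℂ] E).rank ≤ (n + n : ℕ) :=
    (isClosed_setOf_rank_le (n + n)).mem_of_tendsto hslope hrank
  refine (hasDerivAt_iff_tendsto_slope (f' := trOn (deriv f z)).mpr ?_).differentiableAt
  rw [tendsto_iff_norm_sub_tendsto_zero] at hslope ⊢
  have hlim := hslope.const_mul ((n + n + (n + n) : ℕ) : ℝ)
  rw [mul_zero] at hlim
  refine squeeze_zero' (Eventually.of_forall fun _ => norm_nonneg _) ?_ hlim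
  filter_upwards [hrank, nhdsWithin_le_nhds hr] with w hw hrw
  have h1 : slope (fun w => trOn (f w)) z w = trOn (slope f z w) := by
    have h2 := rank_smul_sub_le hrw hrz 1
    rw [one_smul] at h2
    rw [slope_def_module, slope_def_module, trOn_smul (isFiniteRank_of_rank_le h2),
      trOn_sub (isFiniteRank_of_rank_le hrw) (isFiniteRank_of_rank_le hrz), smul_eq_mul]
  rw [h1, ← trOn_sub (isFiniteRank_of_rank_le hw) (isFiniteRank_of_rank_le hderiv)]
  have h3 := rank_smul_sub_le hw hderiv 1
  rw [one_smul] at h3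
  exact norm_trOn_le h3

theorem analyticOnNhd_trOn_of_rank_le {U : Set ℂ} (hU : IsOpen U) {f : ℂ → E →L[ℂ] E} {n : ℕ}
    (hf : AnalyticOnNhd ℂ f U) (hr : ∀ z ∈ U, (f z : E →ₗ[ℂ] E).rank ≤ n) :
    AnalyticOnNhd ℂ (fun z => trOn (f z)) U := by
  refine DifferentiableOn.analyticOnNhd (fun z hz => ?_) hU
  refine (differentiableAt_trOn (n := n) (hf z hz).differentiableAt ?_).differentiableWithinAt
  filter_upwards [hU.mem_nhds hz] with w hw using hr w hw

theorem analyticOnNhd_detOneSub_of_rank_le {U : Set ℂ} (hU : IsOpen U) {f : ℂ → E →L[ℂ] E} {n : ℕ}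
    (hf : AnalyticOnNhd ℂ f U) (hr : ∀ z ∈ U, (f z : E →ₗ[ℂ] E).rank ≤ n) :
    AnalyticOnNhd ℂ (fun z => detOneSub (f z)) U := by
  choose! s hcard hdet htr using fun z hz => exists_multiset_detOneSub_trOn_pow (hr z hz)
  have hpow : ∀ k, 1 ≤ k → AnalyticOnNhd ℂ (fun z => trOn (f z ^ k)) U := fun k hk =>
    analyticOnNhd_trOn_of_rank_le hU (hf.pow k) fun z hz => (rank_pow_le hk).trans (hr z hz)
  have hesymm : ∀ k, AnalyticOnNhd ℂ (fun z => (s z).esymm k) U := by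
    intro k
    induction k using Nat.strong_induction_on with
    | _ k ih =>
      rcases Nat.eq_zero_or_pos k with rfl | hk
      · simpa [Multiset.esymm] using (analyticOnNhd_const : AnalyticOnNhd ℂ (fun _ => (1 : ℂ)) U)
      · have h1 : AnalyticOnNhd ℂ (fun z => (k : ℂ)⁻¹ * ((-1 : ℂ) ^ (k + 1) *
            ∑ a ∈ Finset.HasAntidiagonal.antidiagonal k with a.1 < k,
              (-1 : ℂ) ^ a.1 * (s z).esymm a.1 * trOn (f z ^ a.2))) U := by
          refine analyticOnNhd_const.mul (analyticOnNhd_const.mul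
            (Finset.analyticOnNhd_fun_sum _ fun a ha => ?_))
          rw [Finset.mem_filter, Finset.HasAntidiagonal.mem_antidiagonal] at ha
          exact (analyticOnNhd_const.mul (ih a.1 ha.2)).mul (hpow a.2 (by omega))
        refine h1.congr hU fun z hz => ?_
        have hk0 : (k : ℂ) ≠ 0 := by exact_mod_cast hk.ne'
        rw [inv_mul_eq_iff_eq_mul₀ hk0, Multiset.mul_esymm_eq_sum]
        congr 1
        refine Finset.sum_congr rfl fun a ha => ?_
        rw [Finset.mem_filter, Finset.HasAntidiagonal.mem_antidiagonal] at ha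
        rw [htr z hz a.2 (by omega)]
  have h2 : AnalyticOnNhd ℂ (fun z => ∑ j ∈ Finset.range (n + 1), (-1) ^ j * (s z).esymm j) U :=
    Finset.analyticOnNhd_fun_sum _ fun j _ => analyticOnNhd_const.mul (hesymm j)
  refine h2.congr hU fun z hz => ?_
  rw [hdet z hz, Multiset.prod_map_one_sub_eq_sum_esymm _ (hcard z hz)]

theorem exists_forall_mem_rank_le {U : Set ℂ} (hU : IsOpen U) (hc : IsPreconnected U)
    {f : ℂ → E →L[ℂ] E} (hf : AnalyticOnNhd ℂ f U) (hfr : ∀ z ∈ U, IsFiniteRank (f z)) :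
    ∃ n : ℕ, ∀ z ∈ U, (f z : E →ₗ[ℂ] E).rank ≤ n := by
  rcases U.eq_empty_or_nonempty with rfl | hne
  · exact ⟨0, by simp⟩
  have := hU.baireSpace
  have : Nonempty U := hne.to_subtype
  have hcont : Continuous fun z : U => f z := continuousOn_iff_continuous_domRestrict.mp hf.continuousOn
  obtain ⟨n, ⟨z₀, hz₀⟩, hz₀n⟩ := nonempty_interior_of_iUnion_of_closed
    (f := fun n : ℕ => {z : U | (f z : E →ₗ[ℂ] E).rank ≤ n})
    (fun n => (isClosed_setOf_rank_le n).preimage hcont) (by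
      refine Set.eq_univ_of_forall fun z => Set.mem_iUnion.mpr ?_
      obtain ⟨n, hn⟩ := Cardinal.lt_aleph0.mp (Module.rank_lt_aleph0_iff.mpr (hfr z z.2))
      exact ⟨n, hn.le⟩)
  have hev : ∀ᶠ z in nhds z₀, (f z : E →ₗ[ℂ] E).rank ≤ n := by
    have h1 := mem_interior_iff_mem_nhds.mp hz₀n
    rw [nhds_subtype_eq_comap, Filter.mem_comap] at h1
    obtain ⟨t, ht, hts⟩ := h1
    filter_upwards [ht, hU.mem_nhds hz₀] with z hz hzU
    exact hts (show (⟨z, hzU⟩ : U) ∈ Subtype.val ⁻¹' t from hz)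
  refine ⟨n, fun z hz => (ContinuousLinearMap.rank_le_iff_forall_det_eq_zero _ _).mpr fun x φ => ?_⟩
  have han : AnalyticOnNhd ℂ (fun z => (Matrix.of fun i j => φ i (f z (x j))).det) U := by
    simp only [Matrix.det_apply, Matrix.of_apply]
    refine Finset.analyticOnNhd_fun_sum _ fun σ _ => ?_
    refine AnalyticOnNhd.const_smul (Finset.analyticOnNhd_fun_prod _ fun i _ => ?_)
    exact ((φ (σ i)).comp (ContinuousLinearMap.apply ℂ E (x i))).comp_analyticOnNhd hf
  refine han.eqOn_zero_of_preconnected_of_eventuallyEq_zero hc hz₀ ?_ hz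
  filter_upwards [hev] with w hw
  exact (ContinuousLinearMap.rank_le_iff_forall_det_eq_zero _ _).mp hw x φ

/-- If `f : Ω → B(X)` is analytic on the open set `Ω ⊆ ℂ` and takes finite
rank values on `Ω`, then `z ↦ det(I - f z)` and `z ↦ tr (f z)` are analytic on `Ω`. -/
theorem analyticOnNhd_detOneSub_and_trOn (Ω : Set ℂ) (hΩ : IsOpen Ω)
    (f : ℂ → X →L[ℂ] X) (hf : AnalyticOnNhd ℂ f Ω) (hfr : ∀ z ∈ Ω, IsFiniteRank (f z)) :
    AnalyticOnNhd ℂ (fun z => detOneSub (f z)) Ω ∧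
      AnalyticOnNhd ℂ (fun z => trOn (f z)) Ω := by
  have key : ∀ z ∈ Ω, ∃ U : Set ℂ, IsOpen U ∧ z ∈ U ∧ AnalyticOnNhd ℂ f U ∧
      ∃ n : ℕ, ∀ w ∈ U, (f w : X →ₗ[ℂ] X).rank ≤ n := by
    intro z hz
    obtain ⟨r, hr, hsub⟩ := Metric.isOpen_iff.mp hΩ z hz
    exact ⟨Metric.ball z r, Metric.isOpen_ball, Metric.mem_ball_self hr, hf.mono hsub,
      exists_forall_mem_rank_le Metric.isOpen_ball (convex_ball z r).isPreconnected
        (hf.mono hsub) fun w hw => hfr w (hsub hw)⟩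
  refine ⟨fun z hz => ?_, fun z hz => ?_⟩ <;> obtain ⟨U, hU, hzU, hfU, n, hn⟩ := key z hz
  · exact analyticOnNhd_detOneSub_of_rank_le hU hfU hn z hzU
  · exact analyticOnNhd_trOn_of_rank_le hU hfU hn z hzU
end

section
/- Let X be a complex Banach space, p > 0, F a finite rank operator on X and B a bounded operator on X. Then det_p(I−FB) = det_p(I−BF). -/
open scoped ENNReal

variable {X : Type*} [NormedAddCommGroup X] [NormedSpace ℂ X] [CompleteSpace X]

namespace LinearMap

variable {K V W : Type*} [Field K] [AddCommGroup V] [Module K V] [AddCommGroup W] [Module K W]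

theorem det_id_sub_comp_comm [FiniteDimensional K V] [FiniteDimensional K W]
    (f : V →ₗ[K] W) (g : W →ₗ[K] V) :
    LinearMap.det (LinearMap.id - f ∘ₗ g) = LinearMap.det (LinearMap.id - g ∘ₗ f) := by
  classical
  let b := Module.finBasis K V
  let c := Module.finBasis K W
  rw [← det_toMatrix c, ← det_toMatrix b, map_sub, map_sub, toMatrix_comp c b c,
    toMatrix_comp b c b, toMatrix_id, toMatrix_id, Matrix.det_one_sub_mul_comm]

/-- The endomorphism of its own range induced by `T`. -/
abbrev restrictRange (T : V →ₗ[K] V) : range T →ₗ[K] range T :=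
  T.restrict fun x _ => mem_range_self _ x

section Factorization

variable {T : V →ₗ[K] V} {u : W →ₗ[K] V} {v : V →ₗ[K] W}

theorem range_le_of_eq_comp (h : T = u ∘ₗ v) : range T ≤ range u := by
  subst h
  exact range_comp_le_range v u

theorem restrictRange_eq_comp (h : T = u ∘ₗ v) :
    restrictRange T = (T.rangeRestrict ∘ₗ (range u).subtype) ∘ₗ
      Submodule.inclusion (range_le_of_eq_comp h) := rfl

theorem inclusion_comp_eq_comp (h : T = u ∘ₗ v) :
    Submodule.inclusion (range_le_of_eq_comp h) ∘ₗ (T.rangeRestrict ∘ₗ (range u).subtype) =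
      u.rangeRestrict ∘ₗ (v ∘ₗ (range u).subtype) := by
  ext x
  simp [h]

theorem trace_restrictRange_of_eq_comp [FiniteDimensional K W] (h : T = u ∘ₗ v) :
    trace K _ (restrictRange T) = trace K W (v ∘ₗ u) := by
  have : FiniteDimensional K (range T) :=
    Submodule.finiteDimensional_of_le (range_le_of_eq_comp h)
  rw [restrictRange_eq_comp h, trace_comp_comm', inclusion_comp_eq_comp h, trace_comp_comm']
  rfl

theorem det_id_sub_restrictRange_of_eq_comp [FiniteDimensional K W] (h : T = u ∘ₗ v) :
    LinearMap.det (LinearMap.id - restrictRange T) =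
      LinearMap.det (LinearMap.id - v ∘ₗ u) := by
  have : FiniteDimensional K (range T) :=
    Submodule.finiteDimensional_of_le (range_le_of_eq_comp h)
  rw [restrictRange_eq_comp h, det_id_sub_comp_comm, inclusion_comp_eq_comp h,
    det_id_sub_comp_comm]
  rfl

theorem pow_succ_eq_comp (h : T = u ∘ₗ v) (k : ℕ) :
    T ^ (k + 1) = u ∘ₗ (((v ∘ₗ u) ^ k) ∘ₗ v) := by
  induction k with
  | zero => ext x; simp [h]
  | succ k ih => rw [pow_succ, ih, pow_succ, h]; rfl

theorem trace_restrictRange_pow_succ_of_eq_comp [FiniteDimensional K W] (h : T = u ∘ₗ v)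
    (k : ℕ) : trace K _ (restrictRange (T ^ (k + 1))) = trace K W ((v ∘ₗ u) ^ (k + 1)) := by
  rw [trace_restrictRange_of_eq_comp (pow_succ_eq_comp h k), pow_succ]
  rfl

end Factorization

end LinearMap

omit [CompleteSpace X] in
theorem detOneSub_eq_of_eq_comp {W : Type*} [AddCommGroup W] [Module ℂ W]
    [FiniteDimensional ℂ W] {T : X →L[ℂ] X} {u : W →ₗ[ℂ] X} {v : X →ₗ[ℂ] W}
    (h : (T : X →ₗ[ℂ] X) = u ∘ₗ v) :
    detOneSub T = LinearMap.det (LinearMap.id - v ∘ₗ u) :=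
  LinearMap.det_id_sub_restrictRange_of_eq_comp h

omit [CompleteSpace X] in
theorem trOn_pow_succ_eq_of_eq_comp {W : Type*} [AddCommGroup W] [Module ℂ W]
    [FiniteDimensional ℂ W] {T : X →L[ℂ] X} {u : W →ₗ[ℂ] X} {v : X →ₗ[ℂ] W}
    (h : (T : X →ₗ[ℂ] X) = u ∘ₗ v) (k : ℕ) :
    trOn (T ^ (k + 1)) = LinearMap.trace ℂ W ((v ∘ₗ u) ^ (k + 1)) := by
  rw [← LinearMap.trace_restrictRange_pow_succ_of_eq_comp h k,
    ← ContinuousLinearMap.toLinearMap_pow]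
  rfl

omit [CompleteSpace X] in
theorem detp_eq_of_eq_comp {W : Type*} [AddCommGroup W] [Module ℂ W]
    [FiniteDimensional ℂ W] (p : ℝ) {T : X →L[ℂ] X} {u : W →ₗ[ℂ] X} {v : X →ₗ[ℂ] W}
    (h : (T : X →ₗ[ℂ] X) = u ∘ₗ v) :
    detp p T = LinearMap.det (LinearMap.id - v ∘ₗ u) *
      Complex.exp (∑ k ∈ Finset.Icc 1 (⌈p⌉₊ - 1),
        LinearMap.trace ℂ W ((v ∘ₗ u) ^ k) / (k : ℂ)) := by
  rw [detp, detOneSub_eq_of_eq_comp h]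
  congr 2
  refine Finset.sum_congr rfl fun k hk => ?_
  obtain ⟨j, rfl⟩ := Nat.exists_eq_add_of_le' (Finset.mem_Icc.mp hk).1
  rw [trOn_pow_succ_eq_of_eq_comp h]

/-- For `p > 0`, a finite rank operator `F` and a bounded operator `B` on a
complex Banach space `X`, `det_p(I-FB) = det_p(I-BF)`. -/
theorem detp_comm (p : ℝ) (hp : 0 < p) (F B : X →L[ℂ] X) (hF : IsFiniteRank F) :
    detp p (F * B) = detp p (B * F) := by
  have : FiniteDimensional ℂ (LinearMap.range (F : X →ₗ[ℂ] X)) := hF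
  let F' := (F : X →ₗ[ℂ] X).rangeRestrict
  let ι := (LinearMap.range (F : X →ₗ[ℂ] X)).subtype
  have hFB : ((F * B : X →L[ℂ] X) : X →ₗ[ℂ] X) = ι ∘ₗ (F' ∘ₗ (B : X →ₗ[ℂ] X)) := rfl
  have hBF : ((B * F : X →L[ℂ] X) : X →ₗ[ℂ] X) = ((B : X →ₗ[ℂ] X) ∘ₗ ι) ∘ₗ F' := rfl
  rw [detp_eq_of_eq_comp p hFB, detp_eq_of_eq_comp p hBF, LinearMap.comp_assoc]
end

section
/- For every p > 0 there exists a constant Γ_p > 0 such that for every complex Banach space X and every finite rank operator F on X one has |det_p(I−F)| ≤ exp(Γ_p ∑_k |λ_k(F)|^p), where in the sum each discrete eigenvalue of F is counted according to its algebraic multiplicity. -/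
open scoped ENNReal

variable {X : Type*} [NormedAddCommGroup X] [NormedSpace ℂ X] [CompleteSpace X]

open scoped ENNReal

variable {X : Type*} [NormedAddCommGroup X] [NormedSpace ℂ X] [CompleteSpace X]

/-- The Riesz projection of `T` at `μ`, computed with the circle of radius `r` around `μ`. -/
noncomputable def rieszProjection (T : X →L[ℂ] X) (μ : ℂ) (r : ℝ) : X →L[ℂ] X :=
  (2 * Real.pi * Complex.I)⁻¹ • ∮ z in C(μ, r), resolvent T z

/-- `μ` is a discrete eigenvalue of `T`: an isolated point of the spectrum whose
Riesz projection has finite-dimensional range. -/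
def IsDiscreteEigenvalue (T : X →L[ℂ] X) (μ : ℂ) : Prop :=
  μ ∈ spectrum ℂ T ∧ ∃ r, 0 < r ∧
    (∀ z ∈ Metric.closedBall μ r, z ≠ μ → z ∉ spectrum ℂ T) ∧
    FiniteDimensional ℂ (LinearMap.range ((rieszProjection T μ r : X →L[ℂ] X) : X →ₗ[ℂ] X))

open scoped Classical in
/-- The algebraic multiplicity of `μ`: the dimension of the range of the Riesz projection
computed with a radius isolating `μ` from the rest of the spectrum. -/
noncomputable def algebraicMultiplicity (T : X →L[ℂ] X) (μ : ℂ) : ℕ :=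
  if h : ∃ r, 0 < r ∧ ∀ z ∈ Metric.closedBall μ r, z ≠ μ → z ∉ spectrum ℂ T then
    Module.finrank ℂ (LinearMap.range ((rieszProjection T μ h.choose : X →L[ℂ] X) : X →ₗ[ℂ] X))
  else 0

/-- `∑_j |λ_j(T)|^p`, the sum over the discrete eigenvalues of `T`, counted with
algebraic multiplicity (as an extended nonnegative real). -/
noncomputable def eigSum (p : ℝ) (T : X →L[ℂ] X) : ℝ≥0∞ :=
  ∑' μ : {μ : ℂ // IsDiscreteEigenvalue T μ},
    (algebraicMultiplicity T (μ : ℂ) : ℝ≥0∞) * ENNReal.ofReal (‖(μ : ℂ)‖ ^ p)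

/-- The number of discrete eigenvalues of `T` in the set `S`, counted with algebraic
multiplicity (as an extended nonnegative real). -/
noncomputable def eigCount (T : X →L[ℂ] X) (S : Set ℂ) : ℝ≥0∞ :=
  ∑' μ : {μ : ℂ // μ ∈ S ∧ IsDiscreteEigenvalue T μ},
    (algebraicMultiplicity T (μ : ℂ) : ℝ≥0∞)

universe u

/-- The bound for a Weierstrass elementary factor. -/
lemma exists_norm_elementaryFactor_le (p : ℝ) (hp : 0 < p) :
    ∃ Γ : ℝ, 0 < Γ ∧ ∀ z : ℂ,
      ‖(1 - z) * Complex.exp (∑ k ∈ Finset.Icc 1 (⌈p⌉₊ - 1), z ^ k / (k : ℂ))‖ ≤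
        Real.exp (Γ * ‖z‖ ^ p) := by
  obtain ⟨n, hn⟩ : ∃ n, ⌈p⌉₊ = n + 1 :=
    ⟨⌈p⌉₊ - 1, (Nat.sub_add_cancel (Nat.one_le_ceil_iff.2 hp)).symm⟩
  have hpn : p ≤ n + 1 := by
    have := Nat.le_ceil p
    rw [hn] at this
    exact_mod_cast this
  have hnp : (n : ℝ) < p := Nat.lt_ceil.1 (by omega)
  rw [hn, Nat.add_sub_cancel]
  refine ⟨2 + 2 ^ p * (1 + 1 / p + n), by positivity, fun z => ?_⟩
  have hrp : 0 ≤ ‖z‖ ^ p := by positivity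
  rcases le_or_gt ‖z‖ (1 / 2) with hz | hz
  · have hz1 : ‖z‖ < 1 := by linarith
    have hne : (1 - z) ≠ 0 := by
      intro h
      rw [← sub_eq_zero.1 h, norm_one] at hz1
      exact lt_irrefl _ hz1
    have hsum : Complex.logTaylor (n + 1) (-z) =
        -∑ k ∈ Finset.Icc 1 n, z ^ k / (k : ℂ) := by
      rw [Complex.logTaylor, Finset.sum_range_succ', ← Finset.sum_neg_distrib]
      simp only [Nat.cast_zero, div_zero, add_zero]
      rw [← Finset.sum_image (f := fun k : ℕ => (-1 : ℂ) ^ (k + 1) * (-z) ^ k / k)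
        (g := fun k => k + 1) (by simp)]
      refine Finset.sum_congr ?_ fun k _ => ?_
      · ext k
        simp only [Finset.mem_image, Finset.mem_range, Finset.mem_Icc]
        exact ⟨fun ⟨a, ha, h⟩ => by omega, fun h => ⟨k - 1, by omega, by omega⟩⟩
      · rw [neg_pow z, ← mul_assoc, ← pow_add, Odd.neg_one_pow ⟨k, by ring⟩]
        ring
    have hb := Complex.norm_log_one_sub_inv_add_logTaylor_neg_le n hz1
    have hexp : (1 - z) * Complex.exp (∑ k ∈ Finset.Icc 1 n, z ^ k / (k : ℂ)) =
        Complex.exp (-(Complex.log (1 - z)⁻¹ + Complex.logTaylor (n + 1) (-z))) := by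
      rw [hsum, neg_add, neg_neg, Complex.exp_add, Complex.exp_neg,
        Complex.exp_log (inv_ne_zero hne), inv_inv]
    rw [hexp]
    refine (Complex.norm_exp_le_exp_norm _).trans (Real.exp_le_exp.2 ?_)
    rw [norm_neg]
    refine hb.trans ?_
    have h1 : ‖z‖ ^ (n + 1) ≤ ‖z‖ ^ p := by
      rw [← Real.rpow_natCast]
      exact Real.rpow_le_rpow_of_exponent_ge' (norm_nonneg _) hz1.le hp.le
        (by push_cast; exact hpn)
    have h2 : (1 - ‖z‖)⁻¹ ≤ 2 := by
      rw [inv_le_comm₀ (by linarith) (by norm_num)]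
      linarith
    calc ‖z‖ ^ (n + 1) * (1 - ‖z‖)⁻¹ / (n + 1) ≤ ‖z‖ ^ (n + 1) * (1 - ‖z‖)⁻¹ := by
          refine div_le_self (mul_nonneg (by positivity) (inv_nonneg.2 (by linarith))) ?_
          linarith [(Nat.cast_nonneg n : (0 : ℝ) ≤ n)]
      _ ≤ ‖z‖ ^ p * 2 := by gcongr
      _ ≤ (2 + 2 ^ p * (1 + 1 / p + n)) * ‖z‖ ^ p := by
          rw [mul_comm]
          gcongr
          have : 0 ≤ 2 ^ p * (1 + 1 / p + n) := by positivity
          linarith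
  · set r : ℝ := 2 * ‖z‖ with hr
    have hr1 : 1 ≤ r := by linarith
    have hrp1 : 1 ≤ r ^ p := Real.one_le_rpow hr1 hp.le
    have hrz : r ^ p = 2 ^ p * ‖z‖ ^ p := Real.mul_rpow (by norm_num) (norm_nonneg _)
    have hA : ‖1 - z‖ ≤ Real.exp ((1 + 1 / p) * r ^ p) := by
      have h1 : ‖1 - z‖ ≤ 2 * r := by
        refine (norm_sub_le _ _).trans ?_
        rw [norm_one]
        linarith
      have h2 : (2 : ℝ) ≤ Real.exp (r ^ p) := by
        linarith [Real.add_one_le_exp (r ^ p)]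
      have h3 : r ≤ Real.exp (1 / p * r ^ p) := by
        have h4 : Real.log r ≤ 1 / p * r ^ p := by
          have := Real.log_le_sub_one_of_pos (x := r ^ p) (by positivity)
          rw [Real.log_rpow (by linarith)] at this
          rw [one_div, ← div_eq_inv_mul, le_div_iff₀ hp]
          linarith
        exact (Real.log_le_iff_le_exp (by linarith)).1 h4
      rw [add_mul, one_mul, Real.exp_add]
      exact h1.trans (by gcongr)
    have hB : ‖∑ k ∈ Finset.Icc 1 n, z ^ k / (k : ℂ)‖ ≤ n * r ^ p := by
      refine (norm_sum_le_of_le (f := fun k : ℕ => z ^ k / (k : ℂ)) (n := fun _ => r ^ p) _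
        fun k hk => ?_).trans (by simp)
      rw [Finset.mem_Icc] at hk
      have hk1 : (1 : ℝ) ≤ k := by exact_mod_cast hk.1
      have hkn : (k : ℝ) ≤ n := by exact_mod_cast hk.2
      rw [norm_div, norm_pow, Complex.norm_natCast]
      calc ‖z‖ ^ k / k ≤ ‖z‖ ^ k := div_le_self (by positivity) hk1
        _ ≤ r ^ k := by gcongr; linarith [norm_nonneg z]
        _ = r ^ (k : ℝ) := (Real.rpow_natCast _ _).symm
        _ ≤ r ^ p := Real.rpow_le_rpow_of_exponent_le hr1 (by linarith)
    rw [norm_mul]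
    calc _ ≤ Real.exp ((1 + 1 / p) * r ^ p) * Real.exp (n * r ^ p) := by
          gcongr
          exact (Complex.norm_exp_le_exp_norm _).trans (Real.exp_le_exp.2 hB)
      _ = Real.exp ((1 + 1 / p + n) * r ^ p) := by rw [← Real.exp_add]; ring_nf
      _ ≤ _ := by
          rw [hrz]
          apply Real.exp_le_exp.2
          nlinarith

section LinearAlgebra

variable {V : Type*} [AddCommGroup V] [Module ℂ V] [FiniteDimensional ℂ V]

/-- `det (1 - f)` as a product over the eigenvalues of `f`. -/
lemma Module.End.det_one_sub_eq_prod (f : Module.End ℂ V) :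
    LinearMap.det (1 - f) = ∏ μ ∈ f.charpoly.roots.toFinset,
      (1 - μ) ^ Module.finrank ℂ (f.maxGenEigenspace μ) := by
  have h := (IsAlgClosed.splits f.charpoly).eval_eq_prod_roots_of_monic f.charpoly_monic 1
  rw [LinearMap.eval_charpoly, map_one, Finset.prod_multiset_map_count] at h
  rw [h]
  refine Finset.prod_congr rfl fun μ _ => ?_
  rw [Polynomial.count_roots, LinearMap.finrank_maxGenEigenspace_eq]

/-- The trace of `f ^ k` as a sum over the eigenvalues of `f`. -/
lemma Module.End.trace_pow_eq_sum (f : Module.End ℂ V) (k : ℕ) :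
    LinearMap.trace ℂ V (f ^ k) = ∑ μ ∈ f.charpoly.roots.toFinset,
      (Module.finrank ℂ (f.maxGenEigenspace μ) : ℂ) * μ ^ k := by
  have hds := DirectSum.isInternal_submodule_of_iSupIndep_of_iSup_eq_top
    f.independent_maxGenEigenspace f.iSup_maxGenEigenspace_eq_top
  have h_fin : {μ | f.maxGenEigenspace μ ≠ ⊥}.Finite :=
    WellFoundedGT.finite_ne_bot_of_iSupIndep f.independent_maxGenEigenspace
  have hmaps (μ : ℂ) : ∀ x ∈ f.maxGenEigenspace μ, f x ∈ f.maxGenEigenspace μ :=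
    f.mapsTo_maxGenEigenspace_of_comm (Commute.refl f) μ
  rw [LinearMap.trace_eq_sum_trace_restrict' hds h_fin fun μ =>
    f.mapsTo_maxGenEigenspace_of_comm (Commute.pow_right (Commute.refl f) k) μ]
  refine Finset.sum_congr ?_ fun μ _ => ?_
  · ext μ
    rw [Set.Finite.mem_toFinset, Multiset.mem_toFinset,
      ← Multiset.one_le_count_iff_mem, Polynomial.count_roots,
      ← LinearMap.finrank_maxGenEigenspace_eq, Nat.one_le_iff_ne_zero, Ne,
      Submodule.finrank_eq_zero]
    rfl
  · rw [← Module.End.pow_restrict k (hmaps μ)]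
    induction k with
    | zero => simp
    | succ k ih =>
      rw [pow_succ, Module.End.mul_eq_comp,
        LinearMap.trace_comp_eq_mul_of_commute_of_isNilpotent μ
          (Commute.pow_left (Commute.refl _) k)
          (f.isNilpotent_restrict_maxGenEigenspace_sub_algebraMap μ), ih]
      ring

end LinearAlgebra

section Riesz

variable {E G : Type*} [NormedAddCommGroup E] [NormedSpace ℂ E]
  [NormedAddCommGroup G] [NormedSpace ℂ G]

lemma resolvent_mul_sub (T : E →L[ℂ] E) {z : ℂ} (hz : z ∉ spectrum ℂ T) :
    resolvent T z * (algebraMap ℂ _ z - T) = 1 :=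
  Ring.inverse_mul_cancel _ (spectrum.notMem_iff.1 hz)

lemma sub_mul_resolvent (T : E →L[ℂ] E) {z : ℂ} (hz : z ∉ spectrum ℂ T) :
    (algebraMap ℂ _ z - T) * resolvent T z = 1 :=
  Ring.mul_inverse_cancel _ (spectrum.notMem_iff.1 hz)

/-- The action of the resolvent on a generalized eigenvector. -/
lemma resolvent_apply_of_pow_sub_apply_eq_zero (T : E →L[ℂ] E) {z μ : ℂ}
    (hz : z ∉ spectrum ℂ T) (hzμ : z ≠ μ) (n : ℕ) (v : E)
    (hv : (((T : E →ₗ[ℂ] E) - μ • (1 : Module.End ℂ E)) ^ n) v = 0) :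
    resolvent T z v = ∑ j ∈ Finset.range n, (z - μ) ^ (-(j + 1 : ℤ)) •
      (((T : E →ₗ[ℂ] E) - μ • (1 : Module.End ℂ E)) ^ j) v := by
  have hzμ' : z - μ ≠ 0 := sub_ne_zero.2 hzμ
  set N : Module.End ℂ E := (T : E →ₗ[ℂ] E) - μ • (1 : Module.End ℂ E) with hN
  induction n generalizing v with
  | zero =>
    have : v = 0 := hv
    simp [this]
  | succ n ih =>
    have h1 : resolvent T z v = (z - μ)⁻¹ • (v + resolvent T z (N v)) := by
      have h2 : resolvent T z (z • v - T v) = v := by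
        have := congrArg (fun A : E →L[ℂ] E => A v) (resolvent_mul_sub T hz)
        simpa [Algebra.algebraMap_eq_smul_one] using this
      have h3 : N v = T v - μ • v := by simp [hN]
      rw [eq_inv_smul_iff₀ hzμ', h3]
      nth_rewrite 2 [← h2]
      rw [← map_add, ← map_smul]
      congr 1
      module
    rw [h1, ih (N v) (by rwa [pow_succ] at hv), Finset.sum_range_succ', smul_add, add_comm,
      Finset.smul_sum]
    congr 1
    · refine Finset.sum_congr rfl fun j _ => ?_
      rw [smul_smul, ← zpow_neg_one, ← zpow_add₀ hzμ', pow_succ, Module.End.mul_apply]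
      congr 2
      push_cast
      ring
    · simp

variable [CompleteSpace E]

/-- Continuous linear maps commute with circle integrals. -/
lemma ContinuousLinearMap.map_circleIntegral [CompleteSpace G] (L : E →L[ℂ] G) {f : ℂ → E} {c : ℂ} {R : ℝ}
    (hf : CircleIntegrable f c R) : L (∮ z in C(c, R), f z) = ∮ z in C(c, R), L (f z) := by
  rw [circleIntegral, circleIntegral, ← L.intervalIntegral_comp_comm hf.out]
  simp

/-- The resolvent is continuous on circles which avoid the spectrum. -/
lemma continuousOn_resolvent (T : E →L[ℂ] E) {s : Set ℂ} (hs : ∀ z ∈ s, z ∉ spectrum ℂ T) :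
    ContinuousOn (resolvent T) s := fun z hz =>
  (spectrum.hasDerivAt_resolvent_const_left
    (spectrum.notMem_iff.1 (hs z hz))).continuousAt.continuousWithinAt

/-- The Riesz projection fixes the generalized eigenvectors. -/
lemma rieszProjection_apply_of_mem_maxGenEigenspace (T : E →L[ℂ] E) {μ : ℂ} {r : ℝ}
    (hr : 0 < r) (hsep : ∀ z ∈ Metric.closedBall μ r, z ≠ μ → z ∉ spectrum ℂ T) {v : E}
    (hv : v ∈ Module.End.maxGenEigenspace (T : E →ₗ[ℂ] E) μ) :
    rieszProjection T μ r v = v := by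
  obtain ⟨n, hn⟩ := (Module.End.mem_maxGenEigenspace _ _ _).1 hv
  have hne : ∀ z ∈ Metric.sphere μ r, z ≠ μ := fun z hz => Metric.ne_of_mem_sphere hz hr.ne'
  have hspec : ∀ z ∈ Metric.sphere μ r, z ∉ spectrum ℂ T := fun z hz =>
    hsep z (Metric.sphere_subset_closedBall hz) (hne z hz)
  have hint : CircleIntegrable (resolvent T) μ r :=
    (continuousOn_resolvent T hspec).circleIntegrable hr.le
  have h1 : (∮ z in C(μ, r), resolvent T z) v = ∮ z in C(μ, r), resolvent T z v :=
    (ContinuousLinearMap.apply ℂ E v).map_circleIntegral hint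
  have hpow (j : ℕ) (w : E) : CircleIntegrable (fun z => (z - μ) ^ (-(j + 1 : ℤ)) • w) μ r := by
    refine ContinuousOn.circleIntegrable hr.le (ContinuousOn.smul ?_ continuousOn_const)
    exact ContinuousOn.zpow₀ (by fun_prop) _ fun z hz => Or.inl (sub_ne_zero.2 (hne z hz))
  rw [rieszProjection, smul_apply, h1,
    circleIntegral.integral_congr hr.le fun z hz =>
      resolvent_apply_of_pow_sub_apply_eq_zero T (hspec z hz) (hne z hz) n v hn,
    circleIntegral.integral_fun_sum fun j _ => hpow j _]
  simp_rw [circleIntegral.integral_smul_const]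
  rcases n with _ | n
  · have : v = 0 := hn
    simp [this]
  · rw [Finset.sum_range_succ', Finset.sum_eq_zero]
    · have : (∮ z in C(μ, r), (z - μ) ^ (-((0 : ℕ) + 1 : ℤ))) = 2 * Real.pi * Complex.I := by
        simp [hr.ne']
      rw [this, zero_add, smul_smul, inv_mul_cancel₀ Complex.two_pi_I_ne_zero]
      simp
    · intro j _
      rw [circleIntegral.integral_sub_zpow_of_ne (by push_cast; omega), zero_smul]

/-- The Riesz projections of a finite rank operator at nonzero points have finite rank. -/
lemma IsFiniteRank.finiteDimensional_range_rieszProjection {T : E →L[ℂ] E}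
    (hT : IsFiniteRank T) {μ : ℂ} (hμ : μ ≠ 0) {r : ℝ} (hr : 0 < r)
    (hsep : ∀ z ∈ Metric.closedBall μ r, z ≠ μ → z ∉ spectrum ℂ T) :
    FiniteDimensional ℂ (LinearMap.range (rieszProjection T μ r : E →ₗ[ℂ] E)) := by
  have hfin : FiniteDimensional ℂ (LinearMap.range (T : E →ₗ[ℂ] E)) := hT
  by_cases h0 : (0 : ℂ) ∈ Metric.closedBall μ r
  · have hunit : IsUnit T := by
      have := spectrum.notMem_iff.1 (hsep 0 h0 hμ.symm)
      simpa using this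
    obtain ⟨u, hu⟩ := hunit
    have htop : LinearMap.range (T : E →ₗ[ℂ] E) = ⊤ := by
      rw [LinearMap.range_eq_top]
      intro y
      refine ⟨(↑u⁻¹ : E →L[ℂ] E) y, ?_⟩
      have := congrArg (fun A : E →L[ℂ] E => A y) u.mul_inv
      rw [hu] at this
      exact this
    rw [htop] at hfin
    have : FiniteDimensional ℂ E := (Submodule.topEquiv (R := ℂ) (M := E)).finiteDimensional
    infer_instance
  · refine Submodule.finiteDimensional_of_le (S₂ := LinearMap.range (T : E →ₗ[ℂ] E)) ?_
    have hspec : ∀ z ∈ Metric.sphere μ r, z ∉ spectrum ℂ T := fun z hz =>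
      hsep z (Metric.sphere_subset_closedBall hz) (Metric.ne_of_mem_sphere hz hr.ne')
    have hz0 : ∀ z ∈ Metric.closedBall μ r, z ≠ 0 := fun z hz h => h0 (h ▸ hz)
    have hres : ∀ z ∈ Metric.sphere μ r,
        resolvent T z = z⁻¹ • (1 : E →L[ℂ] E) + T * z⁻¹ • resolvent T z := by
      intro z hz
      have h := sub_mul_resolvent T (hspec z hz)
      have hz' := hz0 z (Metric.sphere_subset_closedBall hz)
      rw [← h, sub_mul, Algebra.algebraMap_eq_smul_one, smul_mul_assoc, one_mul, smul_sub,
        inv_smul_smul₀ hz', mul_smul_comm, sub_add_cancel]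
    have hinv : ContinuousOn (fun z : ℂ => z⁻¹) (Metric.sphere μ r) :=
      continuousOn_inv₀.mono fun z hz => hz0 z (Metric.sphere_subset_closedBall hz)
    have hint : CircleIntegrable (fun z => z⁻¹ • resolvent T z) μ r :=
      (hinv.smul (continuousOn_resolvent T hspec)).circleIntegrable hr.le
    have hcauchy : (∮ z in C(μ, r), z⁻¹) = 0 := by
      refine DiffContOnCl.circleIntegral_eq_zero hr.le (DifferentiableOn.diffContOnCl ?_)
      rw [closure_ball _ hr.ne']
      exact differentiableOn_inv.mono fun z hz => hz0 z hz
    have hP : (∮ z in C(μ, r), resolvent T z) =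
        T * ∮ z in C(μ, r), z⁻¹ • resolvent T z := by
      rw [circleIntegral.integral_congr hr.le hres, circleIntegral.integral_add,
        circleIntegral.integral_smul_const, hcauchy, zero_smul, zero_add]
      · exact ((ContinuousLinearMap.mul ℂ (E →L[ℂ] E) T).map_circleIntegral hint).symm
      · exact (hinv.smul continuousOn_const).circleIntegrable hr.le
      · exact (continuousOn_const.mul
          (hinv.smul (continuousOn_resolvent T hspec))).circleIntegrable hr.le
    rintro _ ⟨v, rfl⟩
    rw [rieszProjection, hP]
    exact Submodule.smul_mem _ _ (LinearMap.mem_range_self (T : E →ₗ[ℂ] E) _)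

end Riesz

section FiniteRank

variable {E : Type*} [NormedAddCommGroup E] [NormedSpace ℂ E]

/-- The restriction of an operator to its range. -/
noncomputable def restrictRange (T : E →L[ℂ] E) :
    Module.End ℂ (LinearMap.range (T : E →ₗ[ℂ] E)) :=
  (T : E →ₗ[ℂ] E).restrict fun x _ => LinearMap.mem_range_self _ x

/-- The trace of the restriction to the range agrees with the trace of the restriction to any
larger finite-dimensional subspace. -/
lemma trace_restrict_range_eq {W : Type*} [AddCommGroup W] [Module ℂ W] (A : Module.End ℂ W)
    (p : Submodule ℂ W) [FiniteDimensional ℂ p] (hA : LinearMap.range A ≤ p) :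
    LinearMap.trace ℂ (LinearMap.range A)
        (A.restrict fun x _ => LinearMap.mem_range_self A x) =
      LinearMap.trace ℂ p (A.restrict fun x _ => hA (LinearMap.mem_range_self A x)) := by
  have : FiniteDimensional ℂ (LinearMap.range A) := Submodule.finiteDimensional_of_le hA
  exact LinearMap.trace_comp_comm' (Submodule.inclusion hA) (A.rangeRestrict.domRestrict p)

lemma trOn_pow_eq {T : E →L[ℂ] E} (hT : IsFiniteRank T) {k : ℕ} (hk : k ≠ 0) :
    trOn (T ^ k) = LinearMap.trace ℂ _ (restrictRange T ^ k) := by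
  have hfin : FiniteDimensional ℂ (LinearMap.range (T : E →ₗ[ℂ] E)) := hT
  have hle : LinearMap.range ((T : E →ₗ[ℂ] E) ^ k) ≤ LinearMap.range (T : E →ₗ[ℂ] E) := by
    obtain ⟨j, rfl⟩ := Nat.exists_eq_succ_of_ne_zero hk
    rw [pow_succ']
    exact LinearMap.range_comp_le_range _ _
  rw [restrictRange, Module.End.pow_restrict, ← trace_restrict_range_eq _ _ hle]
  rw [trOn]
  congr!
  all_goals simp

lemma mem_spectrum_of_hasEigenvalue_restrictRange {T : E →L[ℂ] E} [CompleteSpace E] {μ : ℂ}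
    (h : (restrictRange T).HasEigenvalue μ) : μ ∈ spectrum ℂ T := by
  obtain ⟨v, hv⟩ := h.exists_hasEigenvector
  rw [ContinuousLinearMap.spectrum_eq]
  refine (Module.End.hasEigenvalue_of_hasEigenvector (x := (v : E)) ⟨?_, ?_⟩).mem_spectrum
  · exact Module.End.mem_eigenspace_iff.2 (congrArg Subtype.val hv.apply_eq_smul)
  · exact fun h0 => hv.2 (Subtype.ext h0)

lemma IsFiniteRank.isCompactOperator {T : E →L[ℂ] E} (hT : IsFiniteRank T) :
    IsCompactOperator T := by
  have hfin : FiniteDimensional ℂ (LinearMap.range (T : E →ₗ[ℂ] E)) := hT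
  have : ProperSpace (LinearMap.range (T : E →ₗ[ℂ] E)) := FiniteDimensional.proper ℂ _
  have h := isCompactOperator_of_locallyCompactSpace_dom (T.codRestrict
    (LinearMap.range (T : E →ₗ[ℂ] E)) fun x => LinearMap.mem_range_self (T : E →ₗ[ℂ] E) x)
  exact h.clm_comp (LinearMap.range (T : E →ₗ[ℂ] E)).subtypeL

/-- The regularized determinant as a product of elementary factors over the eigenvalues. -/
lemma IsFiniteRank.detp_eq_prod {T : E →L[ℂ] E} (hT : IsFiniteRank T) (p : ℝ)
    [FiniteDimensional ℂ (LinearMap.range (T : E →ₗ[ℂ] E))] :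
    detp p T = ∏ μ ∈ (restrictRange T).charpoly.roots.toFinset,
      ((1 - μ) * Complex.exp (∑ k ∈ Finset.Icc 1 (⌈p⌉₊ - 1), μ ^ k / (k : ℂ))) ^
        Module.finrank ℂ ((restrictRange T).maxGenEigenspace μ) := by
  have hdet : detOneSub T = LinearMap.det (1 - restrictRange T) := rfl
  rw [detp, hdet, Module.End.det_one_sub_eq_prod]
  simp_rw [mul_pow, Finset.prod_mul_distrib, ← Complex.exp_nat_mul]
  rw [← Complex.exp_sum]
  simp_rw [Finset.mul_sum]
  rw [Finset.sum_comm]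
  congr 2
  refine Finset.sum_congr rfl fun k hk => ?_
  rw [trOn_pow_eq hT (by rw [Finset.mem_Icc] at hk; omega), Module.End.trace_pow_eq_sum,
    Finset.sum_div]
  simp_rw [mul_div_assoc]

variable [CompleteSpace E]

lemma IsFiniteRank.hasEigenvalue_restrictRange {T : E →L[ℂ] E} (hT : IsFiniteRank T) {μ : ℂ}
    (hμ : μ ≠ 0) (h : μ ∈ spectrum ℂ T) : (restrictRange T).HasEigenvalue μ := by
  obtain ⟨v, hv⟩ :=
    ((hT.isCompactOperator.hasEigenvalue_iff_mem_spectrum hμ).2 h).exists_hasEigenvector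
  have hTv : T v = μ • v := hv.apply_eq_smul
  have hmem : v ∈ LinearMap.range (T : E →ₗ[ℂ] E) :=
    ⟨μ⁻¹ • v, by simp [hTv, smul_smul, hμ]⟩
  refine Module.End.hasEigenvalue_of_hasEigenvector (x := ⟨v, hmem⟩) ⟨?_, ?_⟩
  · exact Module.End.mem_eigenspace_iff.2 (Subtype.ext hTv)
  · exact fun h0 => hv.2 (congrArg Subtype.val h0)

/-- A finite rank operator has finite spectrum. -/
lemma IsFiniteRank.finite_spectrum {T : E →L[ℂ] E} (hT : IsFiniteRank T) :
    (spectrum ℂ T).Finite := by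
  have hfin : FiniteDimensional ℂ (LinearMap.range (T : E →ₗ[ℂ] E)) := hT
  refine ((restrictRange T).charpoly.roots.toFinset.finite_toSet.insert 0).subset fun μ hμ => ?_
  by_cases h0 : μ = 0
  · exact Or.inl h0
  · right
    rw [Finset.mem_coe, Multiset.mem_toFinset,
      Polynomial.mem_roots (restrictRange T).charpoly_monic.ne_zero,
      ← Module.End.hasEigenvalue_iff_isRoot_charpoly]
    exact hT.hasEigenvalue_restrictRange h0 hμ

/-- The spectrum of a finite rank operator consists of isolated points. -/
lemma IsFiniteRank.exists_isolating_radius {T : E →L[ℂ] E} (hT : IsFiniteRank T) (μ : ℂ) :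
    ∃ r, 0 < r ∧ ∀ z ∈ Metric.closedBall μ r, z ≠ μ → z ∉ spectrum ℂ T := by
  have hopen : IsOpen (spectrum ℂ T \ {μ})ᶜ :=
    (hT.finite_spectrum.subset Set.sdiff_subset).isClosed.isOpen_compl
  obtain ⟨r, hr, hsub⟩ :=
    Metric.nhds_basis_closedBall.mem_iff.1 (hopen.mem_nhds (x := μ) (by simp))
  exact ⟨r, hr, fun z hz hne hspec => hsub hz ⟨hspec, hne⟩⟩

lemma IsFiniteRank.isDiscreteEigenvalue {T : E →L[ℂ] E} (hT : IsFiniteRank T) {μ : ℂ}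
    (hμ : μ ≠ 0) (h : μ ∈ spectrum ℂ T) : IsDiscreteEigenvalue T μ := by
  obtain ⟨r, hr, hsep⟩ := hT.exists_isolating_radius μ
  exact ⟨h, r, hr, hsep, hT.finiteDimensional_range_rieszProjection hμ hr hsep⟩

lemma IsFiniteRank.finrank_maxGenEigenspace_le {T : E →L[ℂ] E} (hT : IsFiniteRank T) {μ : ℂ}
    (hμ : μ ≠ 0) :
    Module.finrank ℂ ((restrictRange T).maxGenEigenspace μ) ≤ algebraicMultiplicity T μ := by
  have hex := hT.exists_isolating_radius μ
  rw [algebraicMultiplicity, dif_pos hex]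
  obtain ⟨hr, hsep⟩ := hex.choose_spec
  have := hT.finiteDimensional_range_rieszProjection hμ hr hsep
  have hmap : ((restrictRange T).maxGenEigenspace μ).map
      (LinearMap.range (T : E →ₗ[ℂ] E)).subtype ≤
      LinearMap.range (rieszProjection T μ hex.choose : E →ₗ[ℂ] E) := by
    rintro _ ⟨v, hv, rfl⟩
    refine ⟨v, rieszProjection_apply_of_mem_maxGenEigenspace T hr hsep ?_⟩
    have h := Module.End.genEigenspace_restrict (T : E →ₗ[ℂ] E)
      (LinearMap.range (T : E →ₗ[ℂ] E)) ⊤ μ fun x _ => LinearMap.mem_range_self _ x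
    exact h.le hv
  rw [(Submodule.equivMapOfInjective _ (Submodule.subtype_injective _) _).finrank_eq]
  exact Submodule.finrank_mono hmap

lemma IsFiniteRank.eigSum_ne_top {T : E →L[ℂ] E} (hT : IsFiniteRank T) (p : ℝ) :
    eigSum p T ≠ ⊤ := by
  have : Finite {μ : ℂ // IsDiscreteEigenvalue T μ} :=
    (hT.finite_spectrum.subset fun μ (hμ : IsDiscreteEigenvalue T μ) => hμ.1).to_subtype
  have := Fintype.ofFinite {μ : ℂ // IsDiscreteEigenvalue T μ}
  rw [eigSum, tsum_fintype]
  exact ENNReal.sum_ne_top.2 fun μ _ =>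
    ENNReal.mul_ne_top (ENNReal.natCast_ne_top _) ENNReal.ofReal_ne_top

/-- The power sum over the eigenvalues of the restriction to the range is at most the power sum
over the discrete eigenvalues. -/
lemma IsFiniteRank.sum_le_eigSum {T : E →L[ℂ] E} (hT : IsFiniteRank T) {p : ℝ} (hp : 0 < p)
    [FiniteDimensional ℂ (LinearMap.range (T : E →ₗ[ℂ] E))] :
    ∑ μ ∈ (restrictRange T).charpoly.roots.toFinset,
      (Module.finrank ℂ ((restrictRange T).maxGenEigenspace μ) : ℝ) * ‖μ‖ ^ p ≤
        (eigSum p T).toReal := by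
  refine (ENNReal.ofReal_le_iff_le_toReal (hT.eigSum_ne_top p)).1 ?_
  rw [ENNReal.ofReal_sum_of_nonneg fun μ _ => by positivity, eigSum]
  refine le_of_le_of_eq ?_ (tsum_subtype {μ : ℂ | IsDiscreteEigenvalue T μ} fun μ : ℂ =>
    (algebraicMultiplicity T μ : ℝ≥0∞) * ENNReal.ofReal (‖μ‖ ^ p)).symm
  refine (Finset.sum_le_sum fun μ hμ => ?_).trans (ENNReal.sum_le_tsum _)
  by_cases h0 : μ = 0
  · simp [h0, Real.zero_rpow hp.ne']
  · rw [Multiset.mem_toFinset,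
      Polynomial.mem_roots (restrictRange T).charpoly_monic.ne_zero,
      ← Module.End.hasEigenvalue_iff_isRoot_charpoly] at hμ
    rw [Set.indicator_of_mem (show μ ∈ {μ : ℂ | IsDiscreteEigenvalue T μ} from
        hT.isDiscreteEigenvalue h0 (mem_spectrum_of_hasEigenvalue_restrictRange hμ)),
      ENNReal.ofReal_mul (Nat.cast_nonneg _), ENNReal.ofReal_natCast]
    gcongr
    exact hT.finrank_maxGenEigenspace_le h0

end FiniteRank

/-- For every `p > 0` there is a constant `Γ_p > 0` such that for every
complex Banach space `X` and every finite rank operator `F` on `X`,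
`|det_p(I-F)| ≤ exp(Γ_p ∑_k |λ_k(F)|^p)`, the sum running over the discrete eigenvalues
of `F` counted with algebraic multiplicity. -/
theorem exists_detp_bound (p : ℝ) (hp : 0 < p) :
    ∃ Γ : ℝ, 0 < Γ ∧
      ∀ (X : Type u) [NormedAddCommGroup X] [NormedSpace ℂ X] [CompleteSpace X]
        (F : X →L[ℂ] X), IsFiniteRank F →
          ‖detp p F‖ ≤ Real.exp (Γ * (eigSum p F).toReal) := by
  obtain ⟨Γ, hΓ, hbound⟩ := exists_norm_elementaryFactor_le p hp
  refine ⟨Γ, hΓ, fun X _ _ _ F hF => ?_⟩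
  have hfin : FiniteDimensional ℂ (LinearMap.range (F : X →ₗ[ℂ] X)) := hF
  rw [hF.detp_eq_prod p, norm_prod]
  calc _ ≤ ∏ μ ∈ (restrictRange F).charpoly.roots.toFinset,
        Real.exp (Γ * ((Module.finrank ℂ ((restrictRange F).maxGenEigenspace μ) : ℝ) *
          ‖μ‖ ^ p)) := by
        refine Finset.prod_le_prod (fun _ _ => norm_nonneg _) fun μ _ => ?_
        rw [norm_pow, mul_left_comm, Real.exp_nat_mul]
        exact pow_le_pow_left₀ (norm_nonneg _) (hbound μ) _
    _ = Real.exp (Γ * ∑ μ ∈ (restrictRange F).charpoly.roots.toFinset,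
        (Module.finrank ℂ ((restrictRange F).maxGenEigenspace μ) : ℝ) * ‖μ‖ ^ p) := by
        rw [Finset.mul_sum, Real.exp_sum]
    _ ≤ _ := by
        gcongr
        exact hF.sum_le_eigSum hp
end
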